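/- At each point x ∈ B_δ(0) ∩ ∂ℝ^n_+ one has S_{in}(x) = T_{in}(x) = 0 and ∂_n S_{ik}(x) = ∂_n T_{ik}(x) = 0 for all i,k ∈ {1,…,n−1}; moreover ∂_n S_{nn}(x) = ∂_n T_{nn}(x) = 0 and ∂_n w(x) = 0. -/

import Mathlib

noncomputable section

open MeasureTheory Metric

/-- Euclidean space `ℝ^n`. -/
abbrev Euc (n : ℕ) := EuclideanSpace ℝ (Fin n)

/-- Partial derivative in the `i`-th coordinate direction. -/
def pd {n : ℕ} (i : Fin n) (f : Euc n → ℝ) : Euc n → ℝ :=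
  fun x => fderiv ℝ f x (EuclideanSpace.single i 1)

/-- Kronecker delta. -/
def kd {n : ℕ} (i k : Fin n) : ℝ := if i = k then 1 else 0

/-- The finite set of multi-indices `α` with `2 ≤ |α| ≤ d`. -/
def MIdx (n d : ℕ) : Finset (Fin n → ℕ) :=
  (Fintype.piFinset fun _ : Fin n => Finset.range (d + 1)).filter
    fun α => 2 ≤ ∑ i, α i ∧ ∑ i, α i ≤ d

/-- The standard bubble `u_ε(x) = (ε/(ε² + |x|²))^{(n-2)/2}`. -/
def uE (n : ℕ) (ε : ℝ) : Euc n → ℝ :=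
  fun x => (ε / (ε ^ 2 + ‖x‖ ^ 2)) ^ (((n : ℝ) - 2) / 2)

/-- `S_{ik} = ∂_i V_k + ∂_k V_i - (2/n) (div V) δ_{ik}`. -/
def Sop {n : ℕ} (V : Fin n → Euc n → ℝ) (i k : Fin n) : Euc n → ℝ :=
  fun x => pd i (V k) x + pd k (V i) x - (2 / (n : ℝ)) * (∑ m, pd m (V m) x) * kd i k

/-- `T_{ik} = H_{ik} - S_{ik}`. -/
def Tten {n : ℕ} (H : Fin n → Fin n → Euc n → ℝ) (V : Fin n → Euc n → ℝ) (i k : Fin n) :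
    Euc n → ℝ :=
  fun x => H i k x - Sop V i k x

/-- The tensor `Q_{ik,l}`. -/
def Qop {n : ℕ} (ε : ℝ) (H : Fin n → Fin n → Euc n → ℝ) (V : Fin n → Euc n → ℝ)
    (i k l : Fin n) : Euc n → ℝ :=
  fun x =>
    uE n ε x * pd l (Tten H V i k) x
      - (2 / ((n : ℝ) - 2)) * pd i (uE n ε) x * Tten H V k l x
      - (2 / ((n : ℝ) - 2)) * pd k (uE n ε) x * Tten H V i l x
      + (2 / ((n : ℝ) - 2)) * (∑ p, pd p (uE n ε) x * Tten H V i p x) * kd k l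
      + (2 / ((n : ℝ) - 2)) * (∑ p, pd p (uE n ε) x * Tten H V k p x) * kd i l

/-- The function `w = Σ_l ∂_l u_ε V_l + ((n-2)/(2n)) u_ε div V`. -/
def wop {n : ℕ} (ε : ℝ) (V : Fin n → Euc n → ℝ) : Euc n → ℝ :=
  fun x => (∑ l, pd l (uE n ε) x * V l x)
    + (((n : ℝ) - 2) / (2 * (n : ℝ))) * uE n ε x * (∑ l, pd l (V l) x)

theorem pd_add' {n : ℕ} {i : Fin n} {f g : Euc n → ℝ} {x : Euc n}
    (hf : DifferentiableAt ℝ f x) (hg : DifferentiableAt ℝ g x) :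
    pd i (fun y => f y + g y) x = pd i f x + pd i g x := by
  unfold pd; rw [fderiv_fun_add hf hg]; rfl

theorem pd_sub' {n : ℕ} {i : Fin n} {f g : Euc n → ℝ} {x : Euc n}
    (hf : DifferentiableAt ℝ f x) (hg : DifferentiableAt ℝ g x) :
    pd i (fun y => f y - g y) x = pd i f x - pd i g x := by
  unfold pd; rw [fderiv_fun_sub hf hg]; rfl

theorem pd_mul' {n : ℕ} {i : Fin n} {f g : Euc n → ℝ} {x : Euc n}
    (hf : DifferentiableAt ℝ f x) (hg : DifferentiableAt ℝ g x) :
    pd i (fun y => f y * g y) x = f x * pd i g x + pd i f x * g x := by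
  unfold pd; rw [fderiv_fun_mul hf hg]; simp; ring

theorem pd_sum' {n : ℕ} {i : Fin n} {f : Fin n → Euc n → ℝ} {x : Euc n}
    (hf : ∀ k, DifferentiableAt ℝ (f k) x) :
    pd i (fun y => ∑ k, f k y) x = ∑ k, pd i (f k) x := by
  unfold pd; rw [fderiv_fun_sum (fun k _ => hf k)]; simp

theorem pd_const' {n : ℕ} {i : Fin n} {c : ℝ} {x : Euc n} :
    pd i (fun _ => c) x = 0 := by
  unfold pd; simp

theorem pd_smooth {n : ℕ} {i : Fin n} {f : Euc n → ℝ} (hf : ContDiff ℝ (⊤ : ℕ∞) f) :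
    ContDiff ℝ (⊤ : ℕ∞) (pd i f) := by
  unfold pd
  exact (hf.fderiv_right (m := (⊤ : ℕ∞)) (by simp)).clm_apply contDiff_const

theorem sm_diff {n : ℕ} {f : Euc n → ℝ} (hf : ContDiff ℝ (⊤ : ℕ∞) f) (x : Euc n) :
    DifferentiableAt ℝ f x := hf.differentiable (by simp) x

theorem pd_comm' {n : ℕ} {i k : Fin n} {f : Euc n → ℝ} (hf : ContDiff ℝ (⊤ : ℕ∞) f)
    (x : Euc n) : pd i (pd k f) x = pd k (pd i f) x := by
  have h1 : DifferentiableAt ℝ (fderiv ℝ f) x :=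
    (hf.fderiv_right (m := (⊤ : ℕ∞)) (by simp)).differentiable (by simp) x
  have h2 : IsSymmSndFDerivAt ℝ f x :=
    hf.contDiffAt.isSymmSndFDerivAt (by
      simp only [minSmoothness_of_isRCLikeNormedField]; exact WithTop.coe_le_coe.2 (le_top : (2 : ℕ∞) ≤ ⊤))
  have key : ∀ a b : Fin n, pd a (pd b f) x
      = fderiv ℝ (fderiv ℝ f) x (EuclideanSpace.single a 1) (EuclideanSpace.single b 1) := by
    intro a b
    unfold pd
    rw [fderiv_clm_apply h1 (differentiableAt_const _)]
    simp
  rw [key, key]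
  exact h2 _ _

theorem pd_tan {n : ℕ} {i l : Fin n} (hil : i ≠ l) {f : Euc n → ℝ}
    (hf : ContDiff ℝ (⊤ : ℕ∞) f) (h0 : ∀ y : Euc n, y l = 0 → f y = 0)
    {x : Euc n} (hx : x l = 0) : pd i f x = 0 := by
  unfold pd
  rw [← (sm_diff hf x).lineDeriv_eq_fderiv]
  have : (fun t : ℝ => f (x + t • EuclideanSpace.single i (1 : ℝ))) = fun _ => 0 := by
    funext t
    apply h0
    simp [hx, hil.symm]
  unfold lineDeriv
  rw [this]; simp

theorem uE_smooth (n : ℕ) {ε : ℝ} (hε : 0 < ε) : ContDiff ℝ (⊤ : ℕ∞) (uE n ε) := by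
  unfold uE
  have h : ∀ x : Euc n, 0 < ε ^ 2 + ‖x‖ ^ 2 := fun x => by positivity
  apply ContDiff.rpow_const_of_ne
  · exact contDiff_const.div (contDiff_const.add (contDiff_norm_sq ℝ)) (fun x => (h x).ne')
  · intro x
    exact (div_pos hε (h x)).ne'

theorem uE_pos (n : ℕ) {ε : ℝ} (hε : 0 < ε) (x : Euc n) : 0 < uE n ε x := by
  unfold uE; positivity

/-- a function of the norm has vanishing normal derivative on the boundary -/
theorem pd_even {n : ℕ} {l : Fin n} {f : Euc n → ℝ} (hf : ContDiff ℝ (⊤ : ℕ∞) f)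
    (he : ∀ y z : Euc n, ‖y‖ = ‖z‖ → f y = f z) {x : Euc n} (hx : x l = 0) :
    pd l f x = 0 := by
  unfold pd
  rw [← (sm_diff hf x).lineDeriv_eq_fderiv]
  have h1 : lineDeriv ℝ f x (-EuclideanSpace.single l (1 : ℝ))
      = lineDeriv ℝ f x (EuclideanSpace.single l (1 : ℝ)) := by
    unfold lineDeriv
    congr 1
    funext t
    apply he
    rw [← sq_eq_sq₀ (norm_nonneg _) (norm_nonneg _), norm_add_sq_real, norm_add_sq_real]
    simp [inner_smul_right, EuclideanSpace.inner_single_right, hx]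
  rw [lineDeriv_neg] at h1
  linarith

/-- boundary relations for `S`, `T` and `w` on `B_δ(0) ∩ ∂ℝ^n_+`. -/
theorem statement8 (n : ℕ) (hn : 6 ≤ n) (l₀ : Fin n) (hl₀ : (l₀ : ℕ) = n - 1)
    (d : ℕ) (hd : d = (n - 2) / 2)
    (h : Fin n → Fin n → (Fin n → ℕ) → ℝ)
    (H : Fin n → Fin n → Euc n → ℝ)
    (hHdef : ∀ i k x, H i k x = ∑ α ∈ MIdx n d, h i k α * ∏ m, x m ^ α m)
    (hsymm : ∀ i k x, H i k x = H k i x)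
    (htrace : ∀ x, ∑ i, H i i x = 0)
    (hH1 : ∀ x : Euc n, 0 ≤ x l₀ → ∀ i, H i l₀ x = 0)
    (hH2 : ∀ x : Euc n, x l₀ = 0 → ∀ i, ∑ k, H i k x * x k = 0)
    (hH3 : ∀ x : Euc n, x l₀ = 0 → ∀ i k, pd l₀ (H i k) x = 0)
    (ε : ℝ) (hε : 0 < ε) (δ : ℝ) (hδ : 0 < δ)
    (V : Fin n → Euc n → ℝ) (hV : ∀ i, ContDiff ℝ (⊤ : ℕ∞) (V i))
    (hVb1 : ∀ x : Euc n, x l₀ = 0 → V l₀ x = 0)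
    (hVb2 : ∀ x : Euc n, x l₀ = 0 → ∀ i, i ≠ l₀ → pd l₀ (V i) x = 0)
    (hdiv : ∀ x ∈ Metric.ball (0 : Euc n) δ, 0 ≤ x l₀ → ∀ i,
      ∑ k, pd k (fun y => uE n ε y ^ (2 * (n : ℝ) / ((n : ℝ) - 2)) * Tten H V i k y) x = 0) :
    ∀ x ∈ Metric.ball (0 : Euc n) δ, x l₀ = 0 →
      (∀ i, i ≠ l₀ → Sop V i l₀ x = 0 ∧ Tten H V i l₀ x = 0) ∧
      (∀ i k, i ≠ l₀ → k ≠ l₀ →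
        pd l₀ (Sop V i k) x = 0 ∧ pd l₀ (Tten H V i k) x = 0) ∧
      pd l₀ (Sop V l₀ l₀) x = 0 ∧ pd l₀ (Tten H V l₀ l₀) x = 0 ∧
      pd l₀ (wop ε V) x = 0 := by
  classical
  have hn0 : (6:ℝ) ≤ n := by exact_mod_cast hn
  have hHs : ∀ i k, ContDiff ℝ (⊤ : ℕ∞) (H i k) := by
    intro i k
    rw [show H i k = fun x => ∑ α ∈ MIdx n d, h i k α * ∏ m, x m ^ α m from
      funext (hHdef i k)]
    fun_prop
  have hP : ∀ i k, ContDiff ℝ (⊤ : ℕ∞) (pd i (V k)) := fun i k => pd_smooth (hV k)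
  have hD : ContDiff ℝ (⊤ : ℕ∞) (fun x => ∑ m, pd m (V m) x) :=
    ContDiff.sum fun m _ => hP m m
  have hS : ∀ i k, ContDiff ℝ (⊤ : ℕ∞) (Sop V i k) := by
    intro i k
    unfold Sop
    exact ((hP i k).add (hP k i)).sub ((contDiff_const.mul hD).mul contDiff_const)
  have hT : ∀ i k, ContDiff ℝ (⊤ : ℕ∞) (Tten H V i k) := fun i k => (hHs i k).sub (hS i k)
  have hu := uE_smooth n hε
  have hq : ContDiff ℝ (⊤ : ℕ∞) (fun y => uE n ε y ^ (2 * (n : ℝ) / ((n : ℝ) - 2))) :=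
    hu.rpow_const_of_ne fun x => (uE_pos n hε x).ne'
  have ue : ∀ y z : Euc n, ‖y‖ = ‖z‖ → uE n ε y = uE n ε z := by
    intro y z hyz; unfold uE; rw [hyz]
  have hS0 : ∀ x : Euc n, x l₀ = 0 → ∀ i, i ≠ l₀ → Sop V i l₀ x = 0 := by
    intro x hx i hi
    unfold Sop
    rw [pd_tan hi (hV l₀) hVb1 hx, hVb2 x hx i hi]
    simp [kd, hi]
  have hSs : ∀ i k x, Sop V i k x = Sop V k i x := by
    intro i k x
    unfold Sop kd
    simp only [eq_comm (a := i)]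
    ring
  have hT0 : ∀ x : Euc n, x l₀ = 0 → ∀ i, i ≠ l₀ → Tten H V i l₀ x = 0 := by
    intro x hx i hi
    unfold Tten
    rw [hS0 x hx i hi, hH1 x hx.ge i]; simp
  have hTs : ∀ i k x, Tten H V i k x = Tten H V k i x := by
    intro i k x
    unfold Tten
    rw [hSs, hsymm]
  have hpS : ∀ x i k, pd l₀ (Sop V i k) x = pd l₀ (pd i (V k)) x + pd l₀ (pd k (V i)) x
      - (2 / (n : ℝ)) * (∑ m, pd l₀ (pd m (V m)) x) * kd i k := by
    intro x i k
    unfold Sop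
    have e1 := sm_diff (hP i k) x
    have e2 := sm_diff (hP k i) x
    have e3 := sm_diff hD x
    rw [pd_sub' (e1.fun_add e2) ((e3.const_mul _).mul_const _), pd_add' e1 e2,
      pd_mul' (e3.const_mul _) (differentiableAt_const _),
      pd_mul' (differentiableAt_const _) e3, pd_const', pd_const',
      pd_sum' (fun m => sm_diff (hP m m) x)]
    ring
  have hpT : ∀ x i k, pd l₀ (Tten H V i k) x = pd l₀ (H i k) x - pd l₀ (Sop V i k) x := by
    intro x i k
    exact pd_sub' (sm_diff (hHs i k) x) (sm_diff (hS i k) x)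
  intro x hxb hx
  have hmix : ∀ i k, i ≠ l₀ → k ≠ l₀ → pd l₀ (pd i (V k)) x = 0 := by
    intro i k hi hk
    rw [pd_comm' (hV k)]
    exact pd_tan hi (hP l₀ k) (fun y hy => hVb2 y hy k hk) hx
  have hsum : ∑ m, pd l₀ (pd m (V m)) x = pd l₀ (pd l₀ (V l₀)) x := by
    apply Finset.sum_eq_single l₀
    · intro b _ hb; exact hmix b b hb hb
    · simp
  have hTnn : pd l₀ (Tten H V l₀ l₀) x = 0 := by
    have h1 := hdiv x hxb hx.ge l₀
    rw [Finset.sum_eq_single l₀] at h1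
    · rw [pd_mul' (sm_diff hq x) (sm_diff (hT _ _) x),
        pd_even hq (fun y z hyz => by rw [ue y z hyz]) hx] at h1
      have := Real.rpow_pos_of_pos (uE_pos n hε x) (2 * (n : ℝ) / ((n : ℝ) - 2))
      simpa [this.ne'] using h1
    · intro k _ hk
      refine pd_tan hk (hq.mul (hT _ _)) (fun y hy => ?_) hx
      rw [hTs, hT0 y hy k hk, mul_zero]
    · simp
  have hSnn : pd l₀ (Sop V l₀ l₀) x = 0 := by
    have := hpT x l₀ l₀
    rw [hTnn, hH3 x hx] at this
    linarith
  have hVnn : pd l₀ (pd l₀ (V l₀)) x = 0 := by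
    have h1 := hpS x l₀ l₀
    rw [hSnn, hsum] at h1
    simp only [kd, if_true, mul_one] at h1
    have h2 : (2 - 2 / (n:ℝ)) * pd l₀ (pd l₀ (V l₀)) x = 0 := by linarith
    have h3 : 2 / (n:ℝ) < 2 := by
      rw [div_lt_iff₀ (by linarith)]; linarith
    rcases mul_eq_zero.1 h2 with h4 | h4
    · linarith
    · exact h4
  have hSik : ∀ i k, i ≠ l₀ → k ≠ l₀ → pd l₀ (Sop V i k) x = 0 := by
    intro i k hi hk
    rw [hpS, hsum, hVnn, hmix i k hi hk, hmix k i hk hi]; simp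
  refine ⟨fun i hi => ⟨hS0 x hx i hi, hT0 x hx i hi⟩, fun i k hi hk => ⟨hSik i k hi hk, ?_⟩,
    hSnn, hTnn, ?_⟩
  · rw [hpT, hSik i k hi hk, hH3 x hx]; simp
  · have du := sm_diff hu x
    have un : ∀ y : Euc n, y l₀ = 0 → pd l₀ (uE n ε) y = 0 := fun y hy => pd_even hu ue hy
    have dl : ∀ l, DifferentiableAt ℝ (fun y => pd l (uE n ε) y * V l y) x := fun l =>
      (sm_diff (pd_smooth hu) x).fun_mul (sm_diff (hV l) x)
    have e3 := sm_diff hD x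
    unfold wop
    rw [pd_add' (DifferentiableAt.fun_sum fun l _ => dl l) ((du.const_mul _).fun_mul e3),
      pd_sum' dl, pd_mul' (du.const_mul _) e3, pd_mul' (differentiableAt_const _) du,
      pd_const', un x hx, pd_sum' (fun m => sm_diff (hP m m) x), hsum, hVnn,
      Finset.sum_eq_zero]
    · simp
    · intro l _
      rw [pd_mul' (sm_diff (pd_smooth hu) x) (sm_diff (hV l) x)]
      by_cases hl : l = l₀
      · subst hl
        rw [un x hx, hVb1 x hx]; simp
      · rw [hVb2 x hx l hl, pd_comm' hu, pd_tan hl (pd_smooth hu) un hx]; simp
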